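/- Suppose q is invertible in R. Then for every natural number N and every x ∈ R: S_{N+1}(x) = q^N·x·S_N(q^{−1}·x) − S_N(x). -/

import Mathlib

/-- The Gaussian (`q`-binomial) coefficient `[n, k]_q`, defined by the recurrence
`[n, 0]_q = 1`, `[0, k+1]_q = 0`, `[n+1, k+1]_q = [n, k]_q + q^(k+1) * [n, k+1]_q`
(so that `[n+1, k]_q = [n, k-1]_q + q^k * [n, k]_q` and `[n, k]_q = 0` for `k > n`). -/
def qBinom {R : Type*} [CommRing R] (q : R) : ℕ → ℕ → R
  | _, 0 => 1
  | 0, _ + 1 => 0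
  | n + 1, k + 1 => qBinom q n k + q ^ (k + 1) * qBinom q n (k + 1)

/-- `S_N(x) := (-1)^N ∑_{ℓ=0}^{N} [N,ℓ]_q (-x)^ℓ`. -/
def S {R : Type*} [CommRing R] (q : R) (N : ℕ) (x : R) : R :=
  (-1) ^ N * ∑ ℓ ∈ Finset.range (N + 1), qBinom q N ℓ * (-x) ^ ℓ

theorem qBinom_zero_right {R : Type*} [CommRing R] (q : R) (n : ℕ) : qBinom q n 0 = 1 := by
  cases n <;> rfl

theorem qBinom_succ_succ {R : Type*} [CommRing R] (q : R) (n k : ℕ) :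
    qBinom q (n + 1) (k + 1) = qBinom q n k + q ^ (k + 1) * qBinom q n (k + 1) := rfl

theorem qBinom_eq_zero_of_lt {R : Type*} [CommRing R] (q : R) {n k : ℕ} (h : n < k) :
    qBinom q n k = 0 := by
  induction n generalizing k with
  | zero =>
    obtain ⟨k, rfl⟩ := Nat.exists_eq_succ_of_ne_zero h.ne'
    rfl
  | succ n ih =>
    obtain ⟨k, rfl⟩ := Nat.exists_eq_succ_of_ne_zero (Nat.ne_zero_of_lt h)
    rw [Nat.succ_eq_add_one, qBinom_succ_succ, ih (by omega), ih (by omega), mul_zero, add_zero]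

/-- The dual `q`-Pascal recurrence `[n+1, k+1]_q = q^(n-k) * [n, k]_q + [n, k+1]_q`. -/
theorem qBinom_succ_succ' {R : Type*} [CommRing R] (q : R) (n k : ℕ) :
    qBinom q (n + 1) (k + 1) = q ^ (n - k) * qBinom q n k + qBinom q n (k + 1) := by
  induction n generalizing k with
  | zero => cases k <;> simp [qBinom]
  | succ n ih =>
    rw [qBinom_succ_succ q (n + 1) k]
    cases k with
    | zero =>
      have h := ih 0
      have h' := qBinom_succ_succ q n 0
      simp only [qBinom_zero_right, Nat.sub_zero, zero_add, pow_one, mul_one] at h h' ⊢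
      linear_combination q * h - h'
    | succ k =>
      have key : q ^ (k + 2) * q ^ (n - (k + 1)) * qBinom q n (k + 1) =
          q ^ (n - k) * q ^ (k + 1) * qBinom q n (k + 1) := by
        rcases le_or_gt n k with h | h
        · simp only [qBinom_eq_zero_of_lt q (Nat.lt_succ_of_le h), mul_zero]
        · rw [← pow_add, ← pow_add, show k + 2 + (n - (k + 1)) = n - k + (k + 1) by omega]
      rw [Nat.add_sub_add_right]
      linear_combination ih k + q ^ (k + 2) * ih (k + 1) - q ^ (n - k) * qBinom_succ_succ q n k -
        qBinom_succ_succ q n (k + 1) + key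

/-- Recurrence (2.10b): if `q` is invertible, `S_{N+1}(x) = q^N x S_N(q^{-1} x) - S_N(x)`. -/
theorem S_succ' {R : Type*} [CommRing R] (q : R) (hq : IsUnit q) (N : ℕ) (x : R) :
    S q (N + 1) x = q ^ N * x * S q N (Ring.inverse q * x) - S q N x := by
  have hscale : q ^ N * ∑ l ∈ Finset.range (N + 1), qBinom q N l * (-(Ring.inverse q * x)) ^ l =
      ∑ l ∈ Finset.range (N + 1), q ^ (N - l) * qBinom q N l * (-x) ^ l := by
    rw [Finset.mul_sum]
    refine Finset.sum_congr rfl fun l hl => ?_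
    have hl' : N - l + l = N := Nat.sub_add_cancel (Finset.mem_range_succ_iff.mp hl)
    have hinv : q ^ l * Ring.inverse q ^ l = 1 := by
      rw [← mul_pow, Ring.mul_inverse_cancel q hq, one_pow]
    rw [← mul_neg, mul_pow]
    nth_rewrite 1 [← hl']
    rw [pow_add]
    linear_combination q ^ (N - l) * qBinom q N l * (-x) ^ l * hinv
  have hshift : ∑ l ∈ Finset.range (N + 1), qBinom q N (l + 1) * (-x) ^ (l + 1) + 1 =
      ∑ l ∈ Finset.range (N + 1), qBinom q N l * (-x) ^ l := by
    have h := Finset.sum_range_succ' (fun l => qBinom q N l * (-x) ^ l) (N + 1)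
    rw [Finset.sum_range_succ, qBinom_eq_zero_of_lt q (Nat.lt_succ_self N)] at h
    simpa [qBinom_zero_right] using h.symm
  have hpascal : ∑ l ∈ Finset.range (N + 1 + 1), qBinom q (N + 1) l * (-x) ^ l =
      -x * ∑ l ∈ Finset.range (N + 1), q ^ (N - l) * qBinom q N l * (-x) ^ l +
        ∑ l ∈ Finset.range (N + 1), qBinom q N l * (-x) ^ l := by
    rw [← hshift, ← add_assoc, Finset.mul_sum, ← Finset.sum_add_distrib, Finset.sum_range_succ',
      qBinom_zero_right, pow_zero, mul_one]
    congr 1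
    refine Finset.sum_congr rfl fun l _ => ?_
    rw [qBinom_succ_succ']
    ring
  unfold S
  rw [hpascal, ← hscale]
  ring
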